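/- arXiv:1203.2009 — 2 statements merged into one kernel-verified Lean document; each statement's English description precedes it below -/
import Mathlib

section
/- For all 1 < l ≤ L−1, the following identity of rational functions holds: Sym[C(1) · (t_{L−1}^{(1)})^{−1} f_1^{x}(t^{(1)}) · (t_{L−1}^{(2)})^{−1} f_l^{y}(t^{(2)})] = (1/(x−y)) · Sym[(t_{L−1}^{(1)} t_{L−1}^{(2)})^{−1} (f_1^{x}(t^{(1)}) − f_1^{y}(t^{(1)}))(x f_l^{x}(t^{(2)}) − y f_l^{y}(t^{(2)}))] + (1/(x−1)) · Sym[(t_{L−1}^{(1)})^{−1} (f_0(t^{(1)}) − f_1^{x}(t^{(1)}) − x Σ_{m=2}^{L−1} f_m^{x}(t^{(1)})) · (t_{L−1}^{(2)})^{−1} f_l^{y}(t^{(2)})]. Moreover, in the degenerate case where both copies carry the same parameter x, the first term on the right-hand side is replaced by zero. -/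
noncomputable section

open Finset

/-- `f₀(t^{(a)})`, with the convention `t₀^{(a)} = u 0 a` (hypothesised to be `1`). -/
def f0 (L : ℕ) (u : ℕ → ℕ → ℂ) (a : ℕ) : ℂ :=
  ∏ m ∈ Finset.Icc 1 (L - 1), (u (m - 1) a - u m a)⁻¹

/-- `f_n^v(t^{(a)})` for a parameter `v ∈ {x, y}`. -/
def fP (L : ℕ) (v : ℂ) (n : ℕ) (u : ℕ → ℕ → ℂ) (a : ℕ) : ℂ :=
  (1 - v * u (L - 1) a)⁻¹ *
    ∏ m ∈ (Finset.Icc 1 (L - 1)).erase n, (u (m - 1) a - u m a)⁻¹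

/-- `f_{l,k}^v(t^{(a)})`. -/
def fP2 (L : ℕ) (v : ℂ) (l k : ℕ) (u : ℕ → ℕ → ℂ) (a : ℕ) : ℂ :=
  (1 - v * u (L - 1) a)⁻¹ *
    ∏ m ∈ ((Finset.Icc 1 (L - 1)).erase l).erase k, (u (m - 1) a - u m a)⁻¹

/-- The family `t` with the variables `t m 1 ↔ t m 2` swapped for `m ∈ S`. -/
def swapOn (S : Finset ℕ) (t : ℕ → ℕ → ℂ) : ℕ → ℕ → ℂ :=
  fun m a => if m ∈ S then t m (3 - a) else t m a

/-- The symmetrisation over the group `(S₂)^{L-1}`: the sum of the values of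
`g` on all families obtained from `t` by swapping `t m 1 ↔ t m 2` for `m` in a
subset of `{1, …, L-1}`. -/
def symSum (L : ℕ) (t : ℕ → ℕ → ℂ) (g : (ℕ → ℕ → ℂ) → ℂ) : ℂ :=
  ∑ S ∈ (Finset.Icc 1 (L - 1)).powerset, g (swapOn S t)

/-- The factor `C(n)`. -/
def Cf (L n : ℕ) (u : ℕ → ℕ → ℂ) : ℂ :=
  (∑ m ∈ Finset.Icc n (L - 1),
      u m 1 * (-(u m 1 - u (m - 1) 2)⁻¹ + 2 * (u m 1 - u m 2)⁻¹))
  - (∑ m ∈ Finset.Icc n (L - 2), u m 1 * (u m 1 - u (m + 1) 2)⁻¹)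
  + (if n = 1 then u 1 1 * (u 1 1 - 1)⁻¹ else 0)

/-- Edge weight between level `n+1` (values `c`, `d`) and level `n+2` (values `a`, `b`). -/
def edgeW (l n : ℕ) (c d a b : ℂ) : ℂ :=
  (c - a)⁻¹ * (if n + 2 = l then 1 else (d - b)⁻¹)

/-- The new part of the `C` factor at level `n+2`. -/
def edgeC (c d a b : ℂ) : ℂ :=
  a * (-(a - d)⁻¹ + 2 * (a - b)⁻¹) - c * (c - b)⁻¹

/-- Product of all edge weights up to level `n+1`. -/
def PW (l : ℕ) : ℕ → (ℕ → ℕ → ℂ) → ℂ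
  | 0, u => (1 - u 1 2)⁻¹
  | n + 1, u => PW l n u * edgeW l n (u (n + 1) 1) (u (n + 1) 2) (u (n + 2) 1) (u (n + 2) 2)

/-- The `C` factor up to level `n+1`, without the delta term. -/
def CW : ℕ → (ℕ → ℕ → ℂ) → ℂ
  | 0, u => u 1 1 * (-(u 1 1 - 1)⁻¹ + 2 * (u 1 1 - u 1 2)⁻¹)
  | n + 1, u => CW n u + edgeC (u (n + 1) 1) (u (n + 1) 2) (u (n + 2) 1) (u (n + 2) 2)

/-- Partial symmetrisation of the weight, over levels below `n+1`. -/
def pS (l : ℕ) (t : ℕ → ℕ → ℂ) : ℕ → ℂ → ℂ → ℂ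
  | 0, _, b => (1 - b)⁻¹
  | n + 1, a, b =>
      pS l t n (t (n + 1) 1) (t (n + 1) 2) * edgeW l n (t (n + 1) 1) (t (n + 1) 2) a b
      + pS l t n (t (n + 1) 2) (t (n + 1) 1) * edgeW l n (t (n + 1) 2) (t (n + 1) 1) a b

/-- Partial symmetrisation of the weight times `C`, over levels below `n+1`. -/
def qS (l : ℕ) (t : ℕ → ℕ → ℂ) : ℕ → ℂ → ℂ → ℂ
  | 0, a, b => (a * (-(a - 1)⁻¹ + 2 * (a - b)⁻¹)) * (1 - b)⁻¹
  | n + 1, a, b =>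
      (qS l t n (t (n + 1) 1) (t (n + 1) 2) + edgeC (t (n + 1) 1) (t (n + 1) 2) a b *
        pS l t n (t (n + 1) 1) (t (n + 1) 2)) * edgeW l n (t (n + 1) 1) (t (n + 1) 2) a b
      + (qS l t n (t (n + 1) 2) (t (n + 1) 1) + edgeC (t (n + 1) 2) (t (n + 1) 1) a b *
        pS l t n (t (n + 1) 2) (t (n + 1) 1)) * edgeW l n (t (n + 1) 2) (t (n + 1) 1) a b

theorem PW_congr (l n : ℕ) (u v : ℕ → ℕ → ℂ) (h : ∀ k a, k ≤ n + 1 → u k a = v k a) :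
    PW l n u = PW l n v := by
  induction n with
  | zero => simp [PW, h]
  | succ n ih =>
    simp only [PW]
    rw [ih (fun k a hk => h k a (by omega)), h (n+1) _ (by omega), h (n+1) _ (by omega),
      h (n+2) _ (by omega), h (n+2) _ (by omega)]

theorem CW_congr (n : ℕ) (u v : ℕ → ℕ → ℂ) (h : ∀ k a, k ≤ n + 1 → u k a = v k a) :
    CW n u = CW n v := by
  induction n with
  | zero => simp [CW, h]
  | succ n ih =>
    simp only [CW]
    rw [ih (fun k a hk => h k a (by omega)), h (n+1) _ (by omega), h (n+1) _ (by omega),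
      h (n+2) _ (by omega), h (n+2) _ (by omega)]

theorem Icc_succ' (n : ℕ) : Finset.Icc 1 (n + 1) = insert (n + 1) (Finset.Icc 1 n) := by
  ext k; simp only [Finset.mem_Icc, Finset.mem_insert]; omega

theorem swapOn_insert (S : Finset ℕ) (n : ℕ) (t : ℕ → ℕ → ℂ) (k a : ℕ) (hk : k ≤ n) :
    swapOn (insert (n + 1) S) t k a = swapOn S t k a := by
  have : k ≠ n + 1 := by omega
  simp [swapOn, this]

theorem swapOn_out (S : Finset ℕ) (t : ℕ → ℕ → ℂ) (k a : ℕ) (hk : k ∉ S) :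
    swapOn S t k a = t k a := by
  simp [swapOn, hk]

theorem swapOn_in (S : Finset ℕ) (t : ℕ → ℕ → ℂ) (k a : ℕ) (hk : k ∈ S) :
    swapOn S t k a = t k (3 - a) := by
  simp [swapOn, hk]

theorem sum_P (l : ℕ) (t : ℕ → ℕ → ℂ) (n : ℕ) : ∀ G : ℂ → ℂ → ℂ,
    ∑ S ∈ (Finset.Icc 1 (n + 1)).powerset,
      PW l n (swapOn S t) * G (swapOn S t (n + 1) 1) (swapOn S t (n + 1) 2)
    = pS l t n (t (n + 1) 1) (t (n + 1) 2) * G (t (n + 1) 1) (t (n + 1) 2)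
      + pS l t n (t (n + 1) 2) (t (n + 1) 1) * G (t (n + 1) 2) (t (n + 1) 1) := by
  induction n with
  | zero =>
    intro G
    rw [Icc_succ', Finset.sum_powerset_insert (by simp)]
    simp [PW, pS, swapOn]
  | succ n ih =>
    intro G
    rw [Icc_succ', Finset.sum_powerset_insert (by simp)]
    have h1 := ih (fun c d => edgeW l n c d (t (n + 2) 1) (t (n + 2) 2)
      * G (t (n + 2) 1) (t (n + 2) 2))
    have h2 := ih (fun c d => edgeW l n c d (t (n + 2) 2) (t (n + 2) 1)
      * G (t (n + 2) 2) (t (n + 2) 1))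
    have e1 : ∀ S ∈ (Finset.Icc 1 (n + 1)).powerset,
        PW l (n + 1) (swapOn S t) * G (swapOn S t (n + 1 + 1) 1) (swapOn S t (n + 1 + 1) 2)
        = PW l n (swapOn S t) * (edgeW l n (swapOn S t (n + 1) 1) (swapOn S t (n + 1) 2)
          (t (n + 2) 1) (t (n + 2) 2) * G (t (n + 2) 1) (t (n + 2) 2)) := by
      intro S hS
      have hn : n + 2 ∉ S := fun h => by
        have := Finset.mem_powerset.1 hS h
        simp at this
      simp only [PW]
      rw [swapOn_out S t (n + 2) 1 hn, swapOn_out S t (n + 2) 2 hn]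
      ring
    have e2 : ∀ S ∈ (Finset.Icc 1 (n + 1)).powerset,
        PW l (n + 1) (swapOn (insert (n + 1 + 1) S) t) *
          G (swapOn (insert (n + 1 + 1) S) t (n + 1 + 1) 1)
            (swapOn (insert (n + 1 + 1) S) t (n + 1 + 1) 2)
        = PW l n (swapOn S t) * (edgeW l n (swapOn S t (n + 1) 1) (swapOn S t (n + 1) 2)
          (t (n + 2) 2) (t (n + 2) 1) * G (t (n + 2) 2) (t (n + 2) 1)) := by
      intro S hS
      simp only [PW]
      rw [swapOn_in _ t (n + 2) 1 (by simp), swapOn_in _ t (n + 2) 2 (by simp),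
        swapOn_insert S (n + 1) t (n + 1) 1 le_rfl, swapOn_insert S (n + 1) t (n + 1) 2 le_rfl,
        PW_congr l n _ (swapOn S t) (fun k a hk => swapOn_insert S (n + 1) t k a hk)]
      ring
    rw [Finset.sum_congr rfl e1, Finset.sum_congr rfl e2, h1, h2]
    simp only [pS]
    ring

theorem sum_Q (l : ℕ) (t : ℕ → ℕ → ℂ) (n : ℕ) : ∀ G : ℂ → ℂ → ℂ,
    ∑ S ∈ (Finset.Icc 1 (n + 1)).powerset,
      CW n (swapOn S t) * PW l n (swapOn S t) *
        G (swapOn S t (n + 1) 1) (swapOn S t (n + 1) 2)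
    = qS l t n (t (n + 1) 1) (t (n + 1) 2) * G (t (n + 1) 1) (t (n + 1) 2)
      + qS l t n (t (n + 1) 2) (t (n + 1) 1) * G (t (n + 1) 2) (t (n + 1) 1) := by
  induction n with
  | zero =>
    intro G
    rw [Icc_succ', Finset.sum_powerset_insert (by simp)]
    simp [PW, CW, qS, swapOn]
  | succ n ih =>
    intro G
    rw [Icc_succ', Finset.sum_powerset_insert (by simp)]
    have h1 := ih (fun c d => edgeW l n c d (t (n + 2) 1) (t (n + 2) 2)
      * G (t (n + 2) 1) (t (n + 2) 2))
    have h2 := ih (fun c d => edgeW l n c d (t (n + 2) 2) (t (n + 2) 1)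
      * G (t (n + 2) 2) (t (n + 2) 1))
    have h3 := sum_P l t n (fun c d => edgeC c d (t (n + 2) 1) (t (n + 2) 2) *
      (edgeW l n c d (t (n + 2) 1) (t (n + 2) 2) * G (t (n + 2) 1) (t (n + 2) 2)))
    have h4 := sum_P l t n (fun c d => edgeC c d (t (n + 2) 2) (t (n + 2) 1) *
      (edgeW l n c d (t (n + 2) 2) (t (n + 2) 1) * G (t (n + 2) 2) (t (n + 2) 1)))
    have e1 : ∀ S ∈ (Finset.Icc 1 (n + 1)).powerset,
        CW (n + 1) (swapOn S t) * PW l (n + 1) (swapOn S t) *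
          G (swapOn S t (n + 1 + 1) 1) (swapOn S t (n + 1 + 1) 2)
        = CW n (swapOn S t) * PW l n (swapOn S t) *
          (edgeW l n (swapOn S t (n + 1) 1) (swapOn S t (n + 1) 2)
          (t (n + 2) 1) (t (n + 2) 2) * G (t (n + 2) 1) (t (n + 2) 2))
          + PW l n (swapOn S t) * (edgeC (swapOn S t (n + 1) 1) (swapOn S t (n + 1) 2)
          (t (n + 2) 1) (t (n + 2) 2) * (edgeW l n (swapOn S t (n + 1) 1) (swapOn S t (n + 1) 2)
          (t (n + 2) 1) (t (n + 2) 2) * G (t (n + 2) 1) (t (n + 2) 2))) := by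
      intro S hS
      have hn : n + 2 ∉ S := fun h => by
        have := Finset.mem_powerset.1 hS h
        simp at this
      simp only [PW, CW]
      rw [swapOn_out S t (n + 2) 1 hn, swapOn_out S t (n + 2) 2 hn]
      ring
    have e2 : ∀ S ∈ (Finset.Icc 1 (n + 1)).powerset,
        CW (n + 1) (swapOn (insert (n + 1 + 1) S) t) *
        PW l (n + 1) (swapOn (insert (n + 1 + 1) S) t) *
          G (swapOn (insert (n + 1 + 1) S) t (n + 1 + 1) 1)
            (swapOn (insert (n + 1 + 1) S) t (n + 1 + 1) 2)
        = CW n (swapOn S t) * PW l n (swapOn S t) *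
          (edgeW l n (swapOn S t (n + 1) 1) (swapOn S t (n + 1) 2)
          (t (n + 2) 2) (t (n + 2) 1) * G (t (n + 2) 2) (t (n + 2) 1))
          + PW l n (swapOn S t) * (edgeC (swapOn S t (n + 1) 1) (swapOn S t (n + 1) 2)
          (t (n + 2) 2) (t (n + 2) 1) * (edgeW l n (swapOn S t (n + 1) 1) (swapOn S t (n + 1) 2)
          (t (n + 2) 2) (t (n + 2) 1) * G (t (n + 2) 2) (t (n + 2) 1))) := by
      intro S hS
      simp only [PW, CW]
      rw [swapOn_in _ t (n + 2) 1 (by simp), swapOn_in _ t (n + 2) 2 (by simp),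
        swapOn_insert S (n + 1) t (n + 1) 1 le_rfl, swapOn_insert S (n + 1) t (n + 1) 2 le_rfl,
        PW_congr l n _ (swapOn S t) (fun k a hk => swapOn_insert S (n + 1) t k a hk),
        CW_congr n _ (swapOn S t) (fun k a hk => swapOn_insert S (n + 1) t k a hk)]
      ring
    rw [Finset.sum_congr rfl e1, Finset.sum_congr rfl e2, Finset.sum_add_distrib,
      Finset.sum_add_distrib, h1, h2, h3, h4]
    simp only [qS]
    ring

theorem step_pre (a b c d p q : ℂ) (hab : a - b ≠ 0) (hcd : c - d ≠ 0) (hca : c - a ≠ 0)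
    (hcb : c - b ≠ 0) (hda : d - a ≠ 0) (hdb : d - b ≠ 0) :
    (c * (p + q) / (c - d) + edgeC c d a b * p) * ((c - a)⁻¹ * (d - b)⁻¹)
    + (d * (q + p) / (d - c) + edgeC d c a b * q) * ((d - a)⁻¹ * (c - b)⁻¹)
    = a * ((p * ((c - a)⁻¹ * (d - b)⁻¹) + q * ((d - a)⁻¹ * (c - b)⁻¹))
      + (p * ((c - b)⁻¹ * (d - a)⁻¹) + q * ((d - b)⁻¹ * (c - a)⁻¹))) / (a - b) := by
  have hdc : d - c = -(c - d) := by ring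
  have had : a - d = -(d - a) := by ring
  have hac : a - c = -(c - a) := by ring
  unfold edgeC
  rw [hdc, had, hac]
  field_simp
  ring

theorem step_half (a b c d p q : ℂ) (hab : a - b ≠ 0) (hcd : c - d ≠ 0) (hca : c - a ≠ 0)
    (hcb : c - b ≠ 0) (hda : d - a ≠ 0) (hdb : d - b ≠ 0) :
    (c * (p + q) / (c - d) + edgeC c d a b * p) * ((c - a)⁻¹ * 1)
    + (d * (q + p) / (d - c) + edgeC d c a b * q) * ((d - a)⁻¹ * 1)
    = (a * (p * ((c - a)⁻¹ * 1) + q * ((d - a)⁻¹ * 1))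
      + b * (p * ((c - b)⁻¹ * 1) + q * ((d - b)⁻¹ * 1))) / (a - b) := by
  have hdc : d - c = -(c - d) := by ring
  have had : a - d = -(d - a) := by ring
  have hac : a - c = -(c - a) := by ring
  unfold edgeC
  rw [hdc, had, hac]
  field_simp
  ring

theorem step_post (a b c d p q : ℂ) (hab : a - b ≠ 0) (hcd : c - d ≠ 0) (hca : c - a ≠ 0)
    (hcb : c - b ≠ 0) (hda : d - a ≠ 0) (hdb : d - b ≠ 0) :
    ((c * p + d * q) / (c - d) + edgeC c d a b * p) * ((c - a)⁻¹ * (d - b)⁻¹)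
    + ((d * q + c * p) / (d - c) + edgeC d c a b * q) * ((d - a)⁻¹ * (c - b)⁻¹)
    = (a * (p * ((c - a)⁻¹ * (d - b)⁻¹) + q * ((d - a)⁻¹ * (c - b)⁻¹))
      + b * (p * ((c - b)⁻¹ * (d - a)⁻¹) + q * ((d - b)⁻¹ * (c - a)⁻¹))) / (a - b) := by
  have hdc : d - c = -(c - d) := by ring
  have had : a - d = -(d - a) := by ring
  have hac : a - c = -(c - a) := by ring
  unfold edgeC
  rw [hdc, had, hac]
  field_simp
  ring

theorem qS_closed (l : ℕ) (hl : 1 < l) (t : ℕ → ℕ → ℂ) (ht01 : t 0 1 = 1) (ht02 : t 0 2 = 1)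
    (n : ℕ)
    (hadj : ∀ m, 1 ≤ m → m ≤ n → ∀ a b, (a = 1 ∨ a = 2) → (b = 1 ∨ b = 2) →
      t (m - 1) a ≠ t m b)
    (hver : ∀ m, 1 ≤ m → m ≤ n → t m 1 ≠ t m 2) :
    ∀ a b : ℂ, a ≠ b → t n 1 ≠ a → t n 1 ≠ b → t n 2 ≠ a → t n 2 ≠ b →
    qS l t n a b = if n + 1 < l then a * (pS l t n a b + pS l t n b a) / (a - b)
      else (a * pS l t n a b + b * pS l t n b a) / (a - b) := by
  induction n with
  | zero =>
    intro a b hab h1 h2 _ _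
    rw [if_pos (by omega)]
    rw [ht01] at h1 h2
    have hab' := sub_ne_zero.2 hab
    have h1' := sub_ne_zero.2 h1
    have h2' := sub_ne_zero.2 h2
    have h3 : a - 1 = -(1 - a) := by ring
    simp only [qS, pS]
    rw [h3]
    field_simp
    ring
  | succ n ih =>
    intro a b hab h1 h2 h3 h4
    have hn := hver (n + 1) (by omega) le_rfl
    have A := fun i j hi hj => hadj (n + 1) (by omega) le_rfl i j hi hj
    simp only [Nat.add_sub_cancel] at A
    have ih' := ih (fun m hm hm' => hadj m hm (by omega)) (fun m hm hm' => hver m hm (by omega))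
    have q1 := ih' (t (n + 1) 1) (t (n + 1) 2) hn (A _ _ (by simp) (by simp))
      (A _ _ (by simp) (by simp)) (A _ _ (by simp) (by simp)) (A _ _ (by simp) (by simp))
    have q2 := ih' (t (n + 1) 2) (t (n + 1) 1) hn.symm (A _ _ (by simp) (by simp))
      (A _ _ (by simp) (by simp)) (A _ _ (by simp) (by simp)) (A _ _ (by simp) (by simp))
    simp only [qS, pS]
    rw [q1, q2]
    have hab' := sub_ne_zero.2 hab
    have h1' := sub_ne_zero.2 h1
    have h2' := sub_ne_zero.2 h2
    have h3' := sub_ne_zero.2 h3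
    have h4' := sub_ne_zero.2 h4
    have hn' := sub_ne_zero.2 hn
    unfold edgeW
    rcases lt_trichotomy (n + 2) l with h | h | h
    · have g1 : n + 1 < l := by omega
      have g2 : n + 1 + 1 < l := by omega
      simp only [if_pos g1, if_pos g2, if_neg h.ne]
      exact step_pre a b _ _ _ _ hab' hn' h1' h2' h3' h4'
    · have g1 : n + 1 < l := by omega
      have g2 : ¬ n + 1 + 1 < l := by omega
      simp only [if_pos g1, if_neg g2, if_pos h]
      exact step_half a b _ _ _ _ hab' hn' h1' h2' h3' h4'
    · have g1 : ¬ n + 1 < l := by omega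
      have g2 : ¬ n + 1 + 1 < l := by omega
      simp only [if_neg g1, if_neg g2, if_neg h.ne']
      exact step_post a b _ _ _ _ hab' hn' h1' h2' h3' h4'

theorem Cf_eq (n : ℕ) (u : ℕ → ℕ → ℂ) (h0 : u 0 2 = 1) :
    Cf (n + 2) 1 u = CW n u + u 1 1 * (u 1 1 - 1)⁻¹ := by
  unfold Cf
  rw [if_pos rfl]
  congr 1
  show (∑ m ∈ Finset.Icc 1 (n + 1), _) - (∑ m ∈ Finset.Icc 1 n, _) = _
  induction n with
  | zero => simp [CW, h0]
  | succ n ih =>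
    rw [Icc_succ' (n + 1), Finset.sum_insert (by simp)]
    have h2 : ∑ m ∈ Finset.Icc 1 (n + 1), u m 1 * (u m 1 - u (m + 1) 2)⁻¹ =
        u (n + 1) 1 * (u (n + 1) 1 - u (n + 2) 2)⁻¹ +
        ∑ m ∈ Finset.Icc 1 n, u m 1 * (u m 1 - u (m + 1) 2)⁻¹ := by
      rw [Icc_succ' n, Finset.sum_insert (by simp)]
    rw [h2]
    simp only [CW, ← ih, edgeC, show n + 1 + 1 - 1 = n + 1 from rfl,
      show n + 1 + 1 = n + 2 from rfl]
    ring

theorem prod_eq (l : ℕ) (hl : 1 < l) (n : ℕ) (u : ℕ → ℕ → ℂ) (h0 : u 0 2 = 1) :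
    (∏ m ∈ (Finset.Icc 1 (n + 1)).erase 1, (u (m - 1) 1 - u m 1)⁻¹) *
    (∏ m ∈ (Finset.Icc 1 (n + 1)).erase l, (u (m - 1) 2 - u m 2)⁻¹) = PW l n u := by
  induction n with
  | zero =>
    have : (1:ℕ) ≠ l := by omega
    rw [Finset.erase_eq_of_notMem (a := l) (by simp; omega)]
    simp [PW, h0]
  | succ n ih =>
    have p1 : ∏ m ∈ (Finset.Icc 1 (n + 1 + 1)).erase 1, (u (m - 1) 1 - u m 1)⁻¹ =
        (u (n + 1) 1 - u (n + 2) 1)⁻¹ *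
          ∏ m ∈ (Finset.Icc 1 (n + 1)).erase 1, (u (m - 1) 1 - u m 1)⁻¹ := by
      rw [Icc_succ' (n + 1), Finset.erase_insert_of_ne (by omega), Finset.prod_insert (by simp)]
      rfl
    have p2 : ∏ m ∈ (Finset.Icc 1 (n + 1 + 1)).erase l, (u (m - 1) 2 - u m 2)⁻¹ =
        (if n + 2 = l then 1 else (u (n + 1) 2 - u (n + 2) 2)⁻¹) *
          ∏ m ∈ (Finset.Icc 1 (n + 1)).erase l, (u (m - 1) 2 - u m 2)⁻¹ := by
      rw [Icc_succ' (n + 1)]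
      by_cases h : n + 2 = l
      · have hm : l ∉ Finset.Icc 1 (n + 1) := by
          rw [Finset.mem_Icc]; omega
        rw [if_pos h, one_mul, show n + 1 + 1 = l from h, Finset.erase_insert hm,
          Finset.erase_eq_of_notMem hm]
      · rw [if_neg h, Finset.erase_insert_of_ne h, Finset.prod_insert (by simp)]
        rfl
    rw [p1, p2]
    simp only [PW, ← ih, edgeW]
    ring

theorem fP_mul (x y : ℂ) (l : ℕ) (hl : 1 < l) (n : ℕ) (u : ℕ → ℕ → ℂ) (h0 : u 0 2 = 1) :
    fP (n + 2) x 1 u 1 * fP (n + 2) y l u 2 =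
      (1 - x * u (n + 1) 1)⁻¹ * (1 - y * u (n + 1) 2)⁻¹ * PW l n u := by
  rw [← prod_eq l hl n u h0]
  unfold fP
  show (1 - x * u (n + 1) 1)⁻¹ * (∏ m ∈ (Finset.Icc 1 (n + 1)).erase 1, _) *
    ((1 - y * u (n + 1) 2)⁻¹ * ∏ m ∈ (Finset.Icc 1 (n + 1)).erase l, _) = _
  ring

theorem tele (n : ℕ) (w : ℕ → ℂ) :
    ∑ m ∈ Finset.Icc 2 (n + 1), (w (m - 1) - w m) = w 1 - w (n + 1) := by
  induction n with
  | zero => simp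
  | succ n ih =>
    have : Finset.Icc 2 (n + 1 + 1) = insert (n + 2) (Finset.Icc 2 (n + 1)) := by
      ext k; simp only [Finset.mem_Icc, Finset.mem_insert]; omega
    rw [this, Finset.sum_insert (by simp), ih]
    simp

theorem f0_eq (x : ℂ) (hx1 : x ≠ 1) (n : ℕ) (u : ℕ → ℕ → ℂ) (h0 : u 0 1 = 1)
    (hadj : ∀ m, 1 ≤ m → m ≤ n + 1 → u (m - 1) 1 - u m 1 ≠ 0)
    (hx : 1 - x * u (n + 1) 1 ≠ 0) :
    1 / (x - 1) * (f0 (n + 2) u 1 - fP (n + 2) x 1 u 1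
      - x * ∑ m ∈ Finset.Icc 2 (n + 1), fP (n + 2) x m u 1)
    = u 1 1 * (u 1 1 - 1)⁻¹ * fP (n + 2) x 1 u 1 := by
  have key : ∀ m ∈ Finset.Icc 1 (n + 1), fP (n + 2) x m u 1 =
      (1 - x * u (n + 1) 1)⁻¹ * f0 (n + 2) u 1 * (u (m - 1) 1 - u m 1) := by
    intro m hm
    have hne := hadj m (Finset.mem_Icc.1 hm).1 (Finset.mem_Icc.1 hm).2
    unfold fP f0
    show (1 - x * u (n + 1) 1)⁻¹ * (∏ m ∈ (Finset.Icc 1 (n + 1)).erase m, _) =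
      (1 - x * u (n + 1) 1)⁻¹ * (∏ m ∈ Finset.Icc 1 (n + 1), _) * _
    rw [← Finset.mul_prod_erase _ _ hm]
    field_simp
  have hs : ∑ m ∈ Finset.Icc 2 (n + 1), fP (n + 2) x m u 1 =
      (1 - x * u (n + 1) 1)⁻¹ * f0 (n + 2) u 1 * (u 1 1 - u (n + 1) 1) := by
    rw [← tele n (fun m => u m 1), Finset.mul_sum]
    refine Finset.sum_congr rfl fun m hm => key m ?_
    simp only [Finset.mem_Icc] at hm ⊢
    omega
  rw [hs, key 1 (by simp)]
  have h1 := hadj 1 le_rfl (by omega)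
  simp only [Nat.sub_self, h0] at h1 ⊢
  have hx1' : x - 1 ≠ 0 := sub_ne_zero.2 hx1
  have h3 : u 1 1 - 1 = -(1 - u 1 1) := by ring
  rw [h3]
  field_simp
  ring

theorem final_alg (a b x y p q : ℂ) (ha : a ≠ 0) (hb : b ≠ 0) (hab : a - b ≠ 0)
    (hxa : 1 - x * a ≠ 0) (hxb : 1 - x * b ≠ 0) (hya : 1 - y * a ≠ 0) (hyb : 1 - y * b ≠ 0) :
    (a * p + b * q) / (a - b) * (a⁻¹ * (1 - x * a)⁻¹ * (b⁻¹ * (1 - y * b)⁻¹))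
    + (b * q + a * p) / (b - a) * (b⁻¹ * (1 - x * b)⁻¹ * (a⁻¹ * (1 - y * a)⁻¹))
    = p * ((x - y) * b⁻¹ * ((1 - x * a)⁻¹ * (1 - y * a)⁻¹ * (1 - x * b)⁻¹ * (1 - y * b)⁻¹))
    + q * ((x - y) * a⁻¹ * ((1 - x * b)⁻¹ * (1 - y * b)⁻¹ * (1 - x * a)⁻¹ * (1 - y * a)⁻¹)) := by
  have h : b - a = -(a - b) := by ring
  rw [h]
  have hxa' : 1 - a * x ≠ 0 := by rwa [mul_comm]
  have hxb' : 1 - b * x ≠ 0 := by rwa [mul_comm]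
  have hya' : 1 - a * y ≠ 0 := by rwa [mul_comm]
  have hyb' : 1 - b * y ≠ 0 := by rwa [mul_comm]
  field_simp
  ring

theorem main_aux (n : ℕ) (t : ℕ → ℕ → ℂ) (x y : ℂ)
    (ht01 : t 0 1 = 1) (ht02 : t 0 2 = 1)
    (hadj : ∀ m, 1 ≤ m → m ≤ n + 1 → ∀ a b, (a = 1 ∨ a = 2) → (b = 1 ∨ b = 2) →
      t (m - 1) a ≠ t m b)
    (hver : ∀ m, 1 ≤ m → m ≤ n + 1 → t m 1 ≠ t m 2)
    (hxt : ∀ a, (a = 1 ∨ a = 2) → 1 - x * t (n + 1) a ≠ 0)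
    (hyt : ∀ a, (a = 1 ∨ a = 2) → 1 - y * t (n + 1) a ≠ 0)
    (htL1 : t (n + 1) 1 ≠ 0) (htL2 : t (n + 1) 2 ≠ 0) (hx1 : x ≠ 1)
    (l : ℕ) (hl : 1 < l) (hln : l ≤ n + 1) :
    symSum (n + 2) t (fun u => Cf (n + 2) 1 u * ((u (n + 1) 1)⁻¹ * fP (n + 2) x 1 u 1) *
          ((u (n + 1) 2)⁻¹ * fP (n + 2) y l u 2))
      = symSum (n + 2) t (fun u => PW l n u * ((x - y) * (u (n + 1) 2)⁻¹ *
          ((1 - x * u (n + 1) 1)⁻¹ * (1 - y * u (n + 1) 1)⁻¹ * (1 - x * u (n + 1) 2)⁻¹ *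
            (1 - y * u (n + 1) 2)⁻¹)))
        + 1 / (x - 1) *
            symSum (n + 2) t (fun u => (u (n + 1) 1)⁻¹ *
              (f0 (n + 2) u 1 - fP (n + 2) x 1 u 1
                - x * ∑ m ∈ Finset.Icc 2 (n + 1), fP (n + 2) x m u 1) *
              ((u (n + 1) 2)⁻¹ * fP (n + 2) y l u 2)) := by
  have hsw : ∀ (S : Finset ℕ) (m a : ℕ), (a = 1 ∨ a = 2) →
      ∃ b, (b = 1 ∨ b = 2) ∧ swapOn S t m a = t m b := by
    intro S m a ha
    by_cases h : m ∈ S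
    · exact ⟨3 - a, by omega, swapOn_in S t m a h⟩
    · exact ⟨a, ha, swapOn_out S t m a h⟩
  have hlhs : symSum (n + 2) t (fun u => Cf (n + 2) 1 u *
        ((u (n + 1) 1)⁻¹ * fP (n + 2) x 1 u 1) * ((u (n + 1) 2)⁻¹ * fP (n + 2) y l u 2))
      = symSum (n + 2) t (fun u => CW n u * PW l n u *
        ((u (n + 1) 1)⁻¹ * (1 - x * u (n + 1) 1)⁻¹ *
          ((u (n + 1) 2)⁻¹ * (1 - y * u (n + 1) 2)⁻¹)))
        + 1 / (x - 1) *
            symSum (n + 2) t (fun u => (u (n + 1) 1)⁻¹ *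
              (f0 (n + 2) u 1 - fP (n + 2) x 1 u 1
                - x * ∑ m ∈ Finset.Icc 2 (n + 1), fP (n + 2) x m u 1) *
              ((u (n + 1) 2)⁻¹ * fP (n + 2) y l u 2)) := by
    unfold symSum
    rw [Finset.mul_sum, ← Finset.sum_add_distrib]
    refine Finset.sum_congr rfl fun S hS => ?_
    have h0 : (0 : ℕ) ∉ S := fun h => by
      have := Finset.mem_powerset.1 hS h
      simp at this
    have u01 : swapOn S t 0 1 = 1 := by rw [swapOn_out S t 0 1 h0, ht01]
    have u02 : swapOn S t 0 2 = 1 := by rw [swapOn_out S t 0 2 h0, ht02]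
    have hu : ∀ m, 1 ≤ m → m ≤ n + 1 → swapOn S t (m - 1) 1 - swapOn S t m 1 ≠ 0 := by
      intro m hm hm'
      obtain ⟨i, hi, e1⟩ := hsw S (m - 1) 1 (by simp)
      obtain ⟨j, hj, e2⟩ := hsw S m 1 (by simp)
      rw [e1, e2]
      exact sub_ne_zero.2 (hadj m hm hm' i j hi hj)
    have hux : 1 - x * swapOn S t (n + 1) 1 ≠ 0 := by
      obtain ⟨i, hi, e1⟩ := hsw S (n + 1) 1 (by simp)
      rw [e1]
      exact hxt i hi
    generalize swapOn S t = u at *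
    beta_reduce
    have F := f0_eq x hx1 n u u01 hu hux
    have G := fP_mul x y l hl n u u02
    rw [Cf_eq n u u02]
    linear_combination CW n u * (u (n + 1) 1)⁻¹ * (u (n + 1) 2)⁻¹ * G
      - (u (n + 1) 1)⁻¹ * ((u (n + 1) 2)⁻¹ * fP (n + 2) y l u 2) * F
  rw [hlhs]
  congr 1
  unfold symSum
  have s1 := sum_Q l t n (fun a b => (a⁻¹ * (1 - x * a)⁻¹ * (b⁻¹ * (1 - y * b)⁻¹)))
  have s2 := sum_P l t n (fun a b => ((x - y) * b⁻¹ *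
    ((1 - x * a)⁻¹ * (1 - y * a)⁻¹ * (1 - x * b)⁻¹ * (1 - y * b)⁻¹)))
  have hv := hver (n + 1) (by omega) le_rfl
  have A := fun i j hi hj => hadj (n + 1) (by omega) le_rfl i j hi hj
  simp only [Nat.add_sub_cancel] at A
  have Q := qS_closed l hl t ht01 ht02 n (fun m hm hm' => hadj m hm (by omega))
    (fun m hm hm' => hver m hm (by omega))
  have q1 := Q (t (n + 1) 1) (t (n + 1) 2) hv (A _ _ (by simp) (by simp))
      (A _ _ (by simp) (by simp)) (A _ _ (by simp) (by simp)) (A _ _ (by simp) (by simp))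
  have q2 := Q (t (n + 1) 2) (t (n + 1) 1) hv.symm (A _ _ (by simp) (by simp))
      (A _ _ (by simp) (by simp)) (A _ _ (by simp) (by simp)) (A _ _ (by simp) (by simp))
  rw [if_neg (by omega)] at q1 q2
  refine s1.trans (Eq.trans ?_ s2.symm)
  rw [q1, q2]
  exact final_alg _ _ x y _ _ htL1 htL2 (sub_ne_zero.2 hv) (hxt 1 (by simp)) (hxt 2 (by simp))
    (hyt 1 (by simp)) (hyt 2 (by simp))

theorem stmt12 (L : ℕ) (hL : 2 ≤ L) (t : ℕ → ℕ → ℂ) (x y : ℂ)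
    (ht01 : t 0 1 = 1) (ht02 : t 0 2 = 1)
    (hadj : ∀ m, 1 ≤ m → m ≤ L - 1 → ∀ a b, (a = 1 ∨ a = 2) → (b = 1 ∨ b = 2) →
      t (m - 1) a ≠ t m b)
    (hver : ∀ m, 1 ≤ m → m ≤ L - 1 → t m 1 ≠ t m 2)
    (hxt : ∀ a, (a = 1 ∨ a = 2) → 1 - x * t (L - 1) a ≠ 0)
    (hyt : ∀ a, (a = 1 ∨ a = 2) → 1 - y * t (L - 1) a ≠ 0)
    (htL1 : t (L - 1) 1 ≠ 0) (htL2 : t (L - 1) 2 ≠ 0)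
    (hxy : x ≠ y) (hx1 : x ≠ 1) :
    -- Statement 12 (Lemma `n < l`, case `n = 1`): generic identity and the
    -- degenerate identity where both copies carry the parameter `x` (the first
    -- term on the right-hand side is then replaced by zero).
    ∀ l, 1 < l → l ≤ L - 1 →
      (symSum L t (fun u => Cf L 1 u * ((u (L - 1) 1)⁻¹ * fP L x 1 u 1) *
          ((u (L - 1) 2)⁻¹ * fP L y l u 2))
        = 1 / (x - y) *
            symSum L t (fun u => (u (L - 1) 1 * u (L - 1) 2)⁻¹ *
              ((fP L x 1 u 1 - fP L y 1 u 1) *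
                (x * fP L x l u 2 - y * fP L y l u 2)))
          + 1 / (x - 1) *
            symSum L t (fun u => (u (L - 1) 1)⁻¹ *
              (f0 L u 1 - fP L x 1 u 1 - x * ∑ m ∈ Finset.Icc 2 (L - 1), fP L x m u 1) *
              ((u (L - 1) 2)⁻¹ * fP L y l u 2)))
      ∧
      (symSum L t (fun u => Cf L 1 u * ((u (L - 1) 1)⁻¹ * fP L x 1 u 1) *
          ((u (L - 1) 2)⁻¹ * fP L x l u 2))
        = 1 / (x - 1) *
            symSum L t (fun u => (u (L - 1) 1)⁻¹ *
              (f0 L u 1 - fP L x 1 u 1 - x * ∑ m ∈ Finset.Icc 2 (L - 1), fP L x m u 1) *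
              ((u (L - 1) 2)⁻¹ * fP L x l u 2))) := by
  intro l hl hlL
  obtain ⟨n, rfl⟩ : ∃ n, L = n + 2 := ⟨L - 2, by omega⟩
  have e : n + 2 - 1 = n + 1 := rfl
  simp only [e] at *
  constructor
  · rw [main_aux n t x y ht01 ht02 hadj hver hxt hyt htL1 htL2 hx1 l hl hlL]
    congr 1
    unfold symSum
    rw [Finset.mul_sum]
    refine Finset.sum_congr rfl fun S hS => ?_
    have hsw : ∀ (m a : ℕ), (a = 1 ∨ a = 2) →
        ∃ b, (b = 1 ∨ b = 2) ∧ swapOn S t m a = t m b := by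
      intro m a ha
      by_cases h : m ∈ S
      · exact ⟨3 - a, by omega, swapOn_in S t m a h⟩
      · exact ⟨a, ha, swapOn_out S t m a h⟩
    have h0 : (0 : ℕ) ∉ S := fun h => by
      have := Finset.mem_powerset.1 hS h
      simp at this
    have u02 : swapOn S t 0 2 = 1 := by rw [swapOn_out S t 0 2 h0, ht02]
    obtain ⟨i, hi, e1⟩ := hsw (n + 1) 1 (by simp)
    obtain ⟨j, hj, e2⟩ := hsw (n + 1) 2 (by simp)
    have hx_i : 1 - x * swapOn S t (n + 1) 1 ≠ 0 := by rw [e1]; exact hxt i hi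
    have hx_j : 1 - x * swapOn S t (n + 1) 2 ≠ 0 := by rw [e2]; exact hxt j hj
    have hy_i : 1 - y * swapOn S t (n + 1) 1 ≠ 0 := by rw [e1]; exact hyt i hi
    have hy_j : 1 - y * swapOn S t (n + 1) 2 ≠ 0 := by rw [e2]; exact hyt j hj
    have ha : swapOn S t (n + 1) 1 ≠ 0 := by
      rw [e1]; rcases hi with rfl | rfl <;> assumption
    have hb : swapOn S t (n + 1) 2 ≠ 0 := by
      rw [e2]; rcases hj with rfl | rfl <;> assumption
    clear e1 e2 hsw
    generalize swapOn S t = u at *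
    have hxy' : x - y ≠ 0 := sub_ne_zero.2 hxy
    have G1 := fP_mul x x l hl n u u02
    have G2 := fP_mul x y l hl n u u02
    have G3 := fP_mul y x l hl n u u02
    have G4 := fP_mul y y l hl n u u02
    have E : (fP (n + 2) x 1 u 1 - fP (n + 2) y 1 u 1) *
        (x * fP (n + 2) x l u 2 - y * fP (n + 2) y l u 2) =
        ((1 - x * u (n + 1) 1)⁻¹ - (1 - y * u (n + 1) 1)⁻¹) *
        (x * (1 - x * u (n + 1) 2)⁻¹ - y * (1 - y * u (n + 1) 2)⁻¹) * PW l n u := by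
      linear_combination x * G1 - y * G2 - x * G3 + y * G4
    beta_reduce
    rw [E]
    generalize PW l n u = P
    generalize u (n + 1) 1 = a at *
    generalize u (n + 1) 2 = b at *
    have hxa' : 1 - a * x ≠ 0 := by rwa [mul_comm]
    have hxb' : 1 - b * x ≠ 0 := by rwa [mul_comm]
    have hya' : 1 - a * y ≠ 0 := by rwa [mul_comm]
    have hyb' : 1 - b * y ≠ 0 := by rwa [mul_comm]
    field_simp
    ring
  · rw [main_aux n t x x ht01 ht02 hadj hver hxt hxt htL1 htL2 hx1 l hl hlL]
    simp [symSum]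
end
end

section
/- For all 1 ≤ n ≤ L−1, the following identity of rational functions holds: Sym[C(n) · (t_{L−1}^{(1)})^{−1} f_n^{x}(t^{(1)}) · (t_{L−1}^{(2)})^{−1} f_n^{y}(t^{(2)})] = ((1 − δ_{n,1})/(x−1)) · Sym[(t_{L−1}^{(1)})^{−1} (−f_0(t^{(1)}) + Σ_{m=1}^{n} f_m^{x}(t^{(1)}) + x Σ_{m=n+1}^{L−1} f_m^{x}(t^{(1)})) · (t_{L−1}^{(2)})^{−1} f_n^{y}(t^{(2)})] + Sym[(t_{L−1}^{(1)})^{−1} f_n^{x}(t^{(1)}) · (t_{L−1}^{(2)})^{−1} f_n^{x}(t^{(2)})] + (y/(x−y)) · Sym[(t_{L−1}^{(1)} t_{L−1}^{(2)})^{−1} (f_n^{x}(t^{(1)}) − f_n^{y}(t^{(1)}))(f_n^{x}(t^{(2)}) − f_n^{y}(t^{(2)}))]. Moreover, in the degenerate case where both copies carry the same parameter x, the last term on the right-hand side is replaced by zero. -/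
noncomputable section

open Finset

/-- Nondegeneracy conditions, stable under the swaps. -/
structure Valid (L : ℕ) (x y : ℂ) (u : ℕ → ℕ → ℂ) : Prop where
  z1 : u 0 1 = 1
  z2 : u 0 2 = 1
  adj : ∀ m, 1 ≤ m → m ≤ L - 1 → ∀ a b, (a = 1 ∨ a = 2) → (b = 1 ∨ b = 2) → u (m - 1) a ≠ u m b
  ver : ∀ m, 1 ≤ m → m ≤ L - 1 → u m 1 ≠ u m 2
  hx : ∀ a, (a = 1 ∨ a = 2) → 1 - x * u (L - 1) a ≠ 0
  hy : ∀ a, (a = 1 ∨ a = 2) → 1 - y * u (L - 1) a ≠ 0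
  h1 : u (L - 1) 1 ≠ 0
  h2 : u (L - 1) 2 ≠ 0

lemma swapOn_cases (S : Finset ℕ) (t : ℕ → ℕ → ℂ) (m : ℕ) :
    (swapOn S t m 1 = t m 1 ∧ swapOn S t m 2 = t m 2) ∨
    (swapOn S t m 1 = t m 2 ∧ swapOn S t m 2 = t m 1) := by
  by_cases h : m ∈ S <;> simp [swapOn, h]

lemma Valid.swap {L : ℕ} {x y : ℂ} {t : ℕ → ℕ → ℂ} (h : Valid L x y t) (S : Finset ℕ) :
    Valid L x y (swapOn S t) := by
  have key : ∀ m a, (a = 1 ∨ a = 2) → ∃ b, (b = 1 ∨ b = 2) ∧ swapOn S t m a = t m b := by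
    intro m a ha
    rcases swapOn_cases S t m with ⟨h1, h2⟩ | ⟨h1, h2⟩ <;> rcases ha with rfl | rfl
    · exact ⟨1, by simp, h1⟩
    · exact ⟨2, by simp, h2⟩
    · exact ⟨2, by simp, h1⟩
    · exact ⟨1, by simp, h2⟩
  have nz : ∀ b, (b = 1 ∨ b = 2) → t (L - 1) b ≠ 0 := by
    rintro b (rfl | rfl)
    · exact h.h1
    · exact h.h2
  constructor
  · rcases swapOn_cases S t 0 with ⟨h1, h2⟩ | ⟨h1, h2⟩
    · rw [h1, h.z1]
    · rw [h1, h.z2]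
  · rcases swapOn_cases S t 0 with ⟨h1, h2⟩ | ⟨h1, h2⟩
    · rw [h2, h.z2]
    · rw [h2, h.z1]
  · intro m hm hm' a b ha hb
    obtain ⟨a', ha', e1⟩ := key (m - 1) a ha
    obtain ⟨b', hb', e2⟩ := key m b hb
    rw [e1, e2]
    exact h.adj m hm hm' a' b' ha' hb'
  · intro m hm hm'
    rcases swapOn_cases S t m with ⟨h1, h2⟩ | ⟨h1, h2⟩
    · rw [h1, h2]; exact h.ver m hm hm'
    · rw [h1, h2]; exact (h.ver m hm hm').symm
  · intro a ha
    obtain ⟨b, hb, e⟩ := key (L - 1) a ha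
    rw [e]; exact h.hx b hb
  · intro a ha
    obtain ⟨b, hb, e⟩ := key (L - 1) a ha
    rw [e]; exact h.hy b hb
  · obtain ⟨b, hb, e⟩ := key (L - 1) 1 (by simp)
    rw [e]; exact nz b hb
  · obtain ⟨b, hb, e⟩ := key (L - 1) 2 (by simp)
    rw [e]; exact nz b hb

/-- `u'` is `u` with the levels in `T` swapped (only the entries `1, 2` matter). -/
def SwapRel (T : Finset ℕ) (u u' : ℕ → ℕ → ℂ) : Prop :=
  (∀ m ∈ T, u' m 1 = u m 2 ∧ u' m 2 = u m 1) ∧ (∀ m, m ∉ T → u' m 1 = u m 1 ∧ u' m 2 = u m 2)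

lemma rel_swap (S T : Finset ℕ) (t : ℕ → ℕ → ℂ) :
    SwapRel T (swapOn S t) (swapOn (symmDiff S T) t) := by
  constructor
  · intro m hm
    by_cases h : m ∈ S <;> simp [swapOn, h, hm, Finset.mem_symmDiff]
  · intro m hm
    by_cases h : m ∈ S <;> simp [swapOn, h, hm, Finset.mem_symmDiff]

/-- The main tool: a function antisymmetric under a swap has zero symmetrisation. -/
lemma symSum_zero {L : ℕ} {x y : ℂ} {t : ℕ → ℕ → ℂ} (h : Valid L x y t)
    (T : Finset ℕ) (hT : T ⊆ Finset.Icc 1 (L - 1)) (g : (ℕ → ℕ → ℂ) → ℂ)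
    (hg : ∀ u u', Valid L x y u → SwapRel T u u' → g u + g u' = 0) : symSum L t g = 0 := by
  have e : symSum L t g = ∑ S ∈ (Finset.Icc 1 (L - 1)).powerset, g (swapOn (symmDiff S T) t) := by
    unfold symSum
    have inv : ∀ S : Finset ℕ, symmDiff (symmDiff S T) T = S := fun S => by
      rw [symmDiff_assoc, symmDiff_self, symmDiff_bot]
    have mem : ∀ S ∈ (Finset.Icc 1 (L - 1)).powerset,
        symmDiff S T ∈ (Finset.Icc 1 (L - 1)).powerset := by
      intro S hS
      rw [Finset.mem_powerset] at hS ⊢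
      intro m hm
      rw [Finset.mem_symmDiff] at hm
      rcases hm with hm | hm
      · exact hS hm.1
      · exact hT hm.1
    refine Finset.sum_bij' (fun S _ => symmDiff S T) (fun S _ => symmDiff S T) mem mem
      (fun S _ => inv S) (fun S _ => inv S) ?_
    intro S _
    simp only [inv]
  have e2 : symSum L t g + symSum L t g = 0 := by
    nth_rewrite 2 [e]
    unfold symSum
    rw [← Finset.sum_add_distrib]
    exact Finset.sum_eq_zero fun S _ => hg _ _ (h.swap S) (rel_swap S T t)
  linear_combination e2 / 2

/-- Product of the inverse links of both chains over `s`. -/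
def BB (s : Finset ℕ) (u : ℕ → ℕ → ℂ) : ℂ :=
  ∏ m ∈ s, ((u (m - 1) 1 - u m 1)⁻¹ * (u (m - 1) 2 - u m 2)⁻¹)

lemma BB_rel {T s : Finset ℕ} {u u' : ℕ → ℕ → ℂ} (h : SwapRel T u u') (h0 : u 0 1 = u 0 2)
    (hs : ∀ m ∈ s, (m - 1 ∈ T ↔ m ∈ T) ∨ m = 1) : BB s u' = BB s u := by
  unfold BB
  refine Finset.prod_congr rfl fun m hm => ?_
  rcases hs m hm with hm | rfl
  · by_cases hT : m ∈ T
    · rw [(h.1 m hT).1, (h.1 m hT).2, (h.1 _ (hm.2 hT)).1, (h.1 _ (hm.2 hT)).2, mul_comm]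
    · have hT' := fun h' => hT (hm.1 h')
      rw [(h.2 m hT).1, (h.2 m hT).2, (h.2 _ hT').1, (h.2 _ hT').2]
  · have e1 : u' 0 1 = u 0 1 := by
      by_cases hT : 0 ∈ T
      · rw [(h.1 0 hT).1, h0]
      · rw [(h.2 0 hT).1]
    have e2 : u' 0 2 = u 0 1 := by
      by_cases hT : 0 ∈ T
      · rw [(h.1 0 hT).2]
      · rw [(h.2 0 hT).2, h0]
    show (u' 0 1 - _)⁻¹ * (u' 0 2 - _)⁻¹ = (u 0 1 - _)⁻¹ * (u 0 2 - _)⁻¹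
    rw [e1, e2, ← h0]
    by_cases hT : 1 ∈ T
    · rw [(h.1 1 hT).1, (h.1 1 hT).2, mul_comm]
    · rw [(h.2 1 hT).1, (h.2 1 hT).2]

lemma fP_mul_s14 (L n : ℕ) (v w : ℂ) (u : ℕ → ℕ → ℂ) :
    fP L v n u 1 * fP L w n u 2 = (1 - v * u (L - 1) 1)⁻¹ * (1 - w * u (L - 1) 2)⁻¹ *
      BB ((Finset.Icc 1 (L - 1)).erase n) u := by
  unfold fP BB
  rw [Finset.prod_mul_distrib]
  ring

/-- Telescoping of the bracket in the first term on the right. -/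
lemma bracket {L : ℕ} {x y : ℂ} {u : ℕ → ℕ → ℂ} (h : Valid L x y u) (n : ℕ) (hn : 1 ≤ n)
    (hnL : n ≤ L - 1) :
    -f0 L u 1 + (∑ m ∈ Finset.Icc 1 n, fP L x m u 1)
      + x * ∑ m ∈ Finset.Icc (n + 1) (L - 1), fP L x m u 1
    = (x - 1) * (u n 1 * (u (n - 1) 1 - u n 1)⁻¹ * fP L x n u 1) := by
  have hne : ∀ m, 1 ≤ m → m ≤ L - 1 → u (m - 1) 1 - u m 1 ≠ 0 := fun m hm hm' =>
    sub_ne_zero.2 (h.adj m hm hm' 1 1 (by simp) (by simp))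
  have hf : ∀ m, 1 ≤ m → m ≤ L - 1 → fP L x m u 1 =
      (u (m - 1) 1 - u m 1) * ((1 - x * u (L - 1) 1)⁻¹ * f0 L u 1) := by
    intro m hm hm'
    unfold fP f0
    rw [← Finset.mul_prod_erase (Finset.Icc 1 (L - 1)) _ (Finset.mem_Icc.2 ⟨hm, hm'⟩)]
    have := hne m hm hm'
    field_simp
  have tel : ∀ k, ∑ m ∈ Finset.Icc 1 k, (u (m - 1) 1 - u m 1) = u 0 1 - u k 1 := by
    intro k
    induction k with
    | zero => simp
    | succ k ih => rw [Finset.sum_Icc_succ_top (by omega), ih]; simp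
  have tel2 : ∀ k, n ≤ k → ∑ m ∈ Finset.Icc (n + 1) k, (u (m - 1) 1 - u m 1) = u n 1 - u k 1 := by
    intro k hk
    induction k, hk using Nat.le_induction with
    | base => simp
    | succ k hk ih => rw [Finset.sum_Icc_succ_top (by omega), ih]; simp
  have s1 : ∑ m ∈ Finset.Icc 1 n, fP L x m u 1 =
      (u 0 1 - u n 1) * ((1 - x * u (L - 1) 1)⁻¹ * f0 L u 1) := by
    rw [← tel, Finset.sum_mul]
    refine Finset.sum_congr rfl fun m hm => ?_
    rw [Finset.mem_Icc] at hm
    exact hf m hm.1 (by omega)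
  have s2 : ∑ m ∈ Finset.Icc (n + 1) (L - 1), fP L x m u 1 =
      (u n 1 - u (L - 1) 1) * ((1 - x * u (L - 1) 1)⁻¹ * f0 L u 1) := by
    rw [← tel2 _ hnL, Finset.sum_mul]
    refine Finset.sum_congr rfl fun m hm => ?_
    rw [Finset.mem_Icc] at hm
    exact hf m (by omega) hm.2
  rw [s1, s2, hf n hn hnL, h.z1]
  have h1 := hne n hn hnL
  have h2 := h.hx 1 (by simp)
  field_simp
  ring

/-- The interior part of `C(n)`. -/
def EE (m : ℕ) (u : ℕ → ℕ → ℂ) : ℂ :=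
  2 * u m 1 * (u m 1 - u m 2)⁻¹ - u (m + 1) 1 * (u (m + 1) 1 - u m 2)⁻¹
    - u m 1 * (u m 1 - u (m + 1) 2)⁻¹

lemma Cf_eq_s14 {L : ℕ} {x y : ℂ} {u : ℕ → ℕ → ℂ} (h : Valid L x y u) (n : ℕ) (hn : 1 ≤ n)
    (hnL : n ≤ L - 1) :
    Cf L n u = (if n = 1 then 0 else -(u n 1 * (u n 1 - u (n - 1) 2)⁻¹))
      + ∑ m ∈ Finset.Ico n (L - 1), EE m u
      + 2 * u (L - 1) 1 * (u (L - 1) 1 - u (L - 1) 2)⁻¹ := by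
  have key : ∀ k, n ≤ k → (∑ m ∈ Finset.Icc n k,
      u m 1 * (-(u m 1 - u (m - 1) 2)⁻¹ + 2 * (u m 1 - u m 2)⁻¹))
      - (∑ m ∈ Finset.Ico n k, u m 1 * (u m 1 - u (m + 1) 2)⁻¹) =
      -(u n 1 * (u n 1 - u (n - 1) 2)⁻¹) + ∑ m ∈ Finset.Ico n k, EE m u
      + 2 * u k 1 * (u k 1 - u k 2)⁻¹ := by
    intro k hk
    induction k, hk using Nat.le_induction with
    | base => simp; ring
    | succ k hk ih =>
      rw [Finset.sum_Icc_succ_top (by omega), Finset.sum_Ico_succ_top hk,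
        Finset.sum_Ico_succ_top hk]
      simp only [Nat.add_sub_cancel]
      unfold EE at *
      linear_combination ih
  have e : Finset.Icc n (L - 2) = Finset.Ico n (L - 1) := by
    ext m; simp only [Finset.mem_Icc, Finset.mem_Ico]; omega
  unfold Cf
  rw [e, key _ hnL]
  split_ifs with h1
  · subst h1
    simp only [Nat.sub_self, h.z2]
    ring
  · ring

/-- The top factor. -/
def TT (L : ℕ) (x y : ℂ) (u : ℕ → ℕ → ℂ) : ℂ :=
  (u (L - 1) 1)⁻¹ * (u (L - 1) 2)⁻¹ * ((1 - x * u (L - 1) 1)⁻¹ * (1 - y * u (L - 1) 2)⁻¹)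

lemma sym_interior {L : ℕ} {x y : ℂ} {t : ℕ → ℕ → ℂ} (h : Valid L x y t) (n m : ℕ) (hn : 1 ≤ n)
    (hnm : n ≤ m) (hm : m < L - 1) :
    symSum L t (fun u => EE m u * TT L x y u * BB ((Finset.Icc 1 (L - 1)).erase n) u) = 0 := by
  refine symSum_zero h (Finset.Icc n m) ?_ _ ?_
  · intro k hk
    rw [Finset.mem_Icc] at hk ⊢
    omega
  intro u u' hu hr
  have hB : ∀ w, BB ((Finset.Icc 1 (L - 1)).erase n) w =
      ((w m 1 - w (m + 1) 1)⁻¹ * (w m 2 - w (m + 1) 2)⁻¹) *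
        BB (((Finset.Icc 1 (L - 1)).erase n).erase (m + 1)) w := by
    intro w
    unfold BB
    rw [← Finset.mul_prod_erase _ _ (show m + 1 ∈ (Finset.Icc 1 (L - 1)).erase n by
      simp only [Finset.mem_erase, Finset.mem_Icc]; omega)]
    simp
  have hB' : BB (((Finset.Icc 1 (L - 1)).erase n).erase (m + 1)) u' =
      BB (((Finset.Icc 1 (L - 1)).erase n).erase (m + 1)) u := by
    refine BB_rel hr (by rw [hu.z1, hu.z2]) ?_
    intro k hk
    simp only [Finset.mem_erase, Finset.mem_Icc] at hk ⊢
    omega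
  obtain ⟨a1, a2⟩ := hr.1 m (Finset.mem_Icc.2 ⟨hnm, le_rfl⟩)
  obtain ⟨b1, b2⟩ := hr.2 (m + 1) (by simp)
  obtain ⟨c1, c2⟩ := hr.2 (L - 1) (by rw [Finset.mem_Icc]; omega)
  have hT : TT L x y u' = TT L x y u := by unfold TT; rw [c1, c2]
  simp only [hB, hB', hT]
  unfold EE
  rw [a1, a2, b1, b2]
  have hv := sub_ne_zero.2 (hu.ver m (by omega) (by omega))
  have adj : ∀ a b, (a = 1 ∨ a = 2) → (b = 1 ∨ b = 2) → u m a ≠ u (m + 1) b :=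
    hu.adj (m + 1) (by omega) (by omega)
  have h11 := sub_ne_zero.2 (adj 1 1 (by simp) (by simp))
  have h12 := sub_ne_zero.2 (adj 1 2 (by simp) (by simp))
  have h21 := sub_ne_zero.2 (adj 2 1 (by simp) (by simp))
  have h22 := sub_ne_zero.2 (adj 2 2 (by simp) (by simp))
  generalize TT L x y u = T
  generalize BB _ u = B
  generalize u m 1 = p at *
  generalize u m 2 = q at *
  generalize u (m + 1) 1 = r at *
  generalize u (m + 1) 2 = s at *
  rw [← neg_sub q r, ← neg_sub p r, ← neg_sub p q]
  simp only [inv_neg]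
  field_simp
  ring

lemma sym_boundary {L : ℕ} {x y : ℂ} {t : ℕ → ℕ → ℂ} (h : Valid L x y t) (n : ℕ) (hn : 2 ≤ n)
    (hnL : n ≤ L - 1) :
    symSum L t (fun u => (-(u n 1 * (u n 1 - u (n - 1) 2)⁻¹) - u n 1 * (u (n - 1) 1 - u n 1)⁻¹)
      * TT L x y u * BB ((Finset.Icc 1 (L - 1)).erase n) u) = 0 := by
  refine symSum_zero h (Finset.Icc 1 (n - 1)) ?_ _ ?_
  · intro k hk
    rw [Finset.mem_Icc] at hk ⊢
    omega
  intro u u' hu hr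
  have hB' : BB ((Finset.Icc 1 (L - 1)).erase n) u' = BB ((Finset.Icc 1 (L - 1)).erase n) u := by
    refine BB_rel hr (by rw [hu.z1, hu.z2]) ?_
    intro k hk
    simp only [Finset.mem_erase, Finset.mem_Icc] at hk ⊢
    omega
  obtain ⟨a1, a2⟩ := hr.1 (n - 1) (Finset.mem_Icc.2 ⟨by omega, le_rfl⟩)
  obtain ⟨b1, b2⟩ := hr.2 n (by rw [Finset.mem_Icc]; omega)
  obtain ⟨c1, c2⟩ := hr.2 (L - 1) (by rw [Finset.mem_Icc]; omega)
  have hT : TT L x y u' = TT L x y u := by unfold TT; rw [c1, c2]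
  simp only [hB', hT]
  rw [a1, a2, b1, ← neg_sub (u (n - 1) 2) (u n 1), ← neg_sub (u (n - 1) 1) (u n 1)]
  simp only [inv_neg]
  ring

lemma sym_top {L : ℕ} {x y : ℂ} {t : ℕ → ℕ → ℂ} (h : Valid L x y t) (n : ℕ) (hn : 1 ≤ n)
    (hnL : n ≤ L - 1) :
    symSum L t (fun u => (2 * u (L - 1) 1 * (u (L - 1) 1 - u (L - 1) 2)⁻¹ * TT L x y u
      - TT L x x u - y * (x - y) * ((1 - x * u (L - 1) 1)⁻¹ * (1 - x * u (L - 1) 2)⁻¹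
        * (1 - y * u (L - 1) 1)⁻¹ * (1 - y * u (L - 1) 2)⁻¹))
      * BB ((Finset.Icc 1 (L - 1)).erase n) u) = 0 := by
  refine symSum_zero h (Finset.Icc n (L - 1)) ?_ _ ?_
  · intro k hk
    rw [Finset.mem_Icc] at hk ⊢
    omega
  intro u u' hu hr
  have hB' : BB ((Finset.Icc 1 (L - 1)).erase n) u' = BB ((Finset.Icc 1 (L - 1)).erase n) u := by
    refine BB_rel hr (by rw [hu.z1, hu.z2]) ?_
    intro k hk
    simp only [Finset.mem_erase, Finset.mem_Icc] at hk ⊢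
    omega
  obtain ⟨c1, c2⟩ := hr.1 (L - 1) (by rw [Finset.mem_Icc]; omega)
  simp only [hB']
  unfold TT
  rw [c1, c2]
  have hv := sub_ne_zero.2 (hu.ver (L - 1) (by omega) (by omega))
  have x1 := hu.hx 1 (by simp)
  have x2 := hu.hx 2 (by simp)
  have y1 := hu.hy 1 (by simp)
  have y2 := hu.hy 2 (by simp)
  have p1 := hu.h1
  have p2 := hu.h2
  generalize BB _ u = B
  generalize u (L - 1) 1 = p at *
  generalize u (L - 1) 2 = q at *
  rw [← neg_sub p q]
  simp only [inv_neg]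
  obtain ⟨X1, e1⟩ : ∃ X, X = 1 - x * p := ⟨_, rfl⟩
  obtain ⟨X2, e2⟩ : ∃ X, X = 1 - x * q := ⟨_, rfl⟩
  obtain ⟨Y1, e3⟩ : ∃ X, X = 1 - y * p := ⟨_, rfl⟩
  obtain ⟨Y2, e4⟩ : ∃ X, X = 1 - y * q := ⟨_, rfl⟩
  rw [← e1, ← e2, ← e3, ← e4]
  rw [← e1] at x1
  rw [← e2] at x2
  rw [← e3] at y1
  rw [← e4] at y2
  field_simp
  rw [e1, e2, e3, e4]
  ring

lemma symSum_congr {L : ℕ} {x y : ℂ} {t : ℕ → ℕ → ℂ} (h : Valid L x y t)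
    {f g : (ℕ → ℕ → ℂ) → ℂ} (hfg : ∀ u, Valid L x y u → f u = g u) :
    symSum L t f = symSum L t g :=
  Finset.sum_congr rfl fun S _ => hfg _ (h.swap S)

lemma symSum_add (L : ℕ) (t : ℕ → ℕ → ℂ) (f g : (ℕ → ℕ → ℂ) → ℂ) :
    symSum L t (fun u => f u + g u) = symSum L t f + symSum L t g :=
  Finset.sum_add_distrib

lemma symSum_mul (L : ℕ) (t : ℕ → ℕ → ℂ) (c : ℂ) (f : (ℕ → ℕ → ℂ) → ℂ) :
    symSum L t (fun u => c * f u) = c * symSum L t f :=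
  (Finset.mul_sum _ _ _).symm

lemma symSum_sum (L : ℕ) (t : ℕ → ℕ → ℂ) (s : Finset ℕ) (f : ℕ → (ℕ → ℕ → ℂ) → ℂ) :
    symSum L t (fun u => ∑ m ∈ s, f m u) = ∑ m ∈ s, symSum L t (f m) :=
  Finset.sum_comm

lemma symSum_split {L : ℕ} {x y : ℂ} {t : ℕ → ℕ → ℂ} (h : Valid L x y t)
    {f g a b c : (ℕ → ℕ → ℂ) → ℂ} (ha : symSum L t a = 0) (hb : symSum L t b = 0)
    (hc : symSum L t c = 0) (hfg : ∀ u, Valid L x y u → f u = g u + (a u + (b u + c u))) :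
    symSum L t f = symSum L t g := by
  rw [symSum_congr h hfg, symSum_add, symSum_add, symSum_add, ha, hb, hc]
  simp

/-- Uniform version, with the last term in a form which makes sense also for `x = y`. -/
lemma core {L : ℕ} {x y : ℂ} {t : ℕ → ℕ → ℂ} (h : Valid L x y t) (hx1 : x ≠ 1) (n : ℕ)
    (hn : 1 ≤ n) (hnL : n ≤ L - 1) :
    symSum L t (fun u => Cf L n u * ((u (L - 1) 1)⁻¹ * fP L x n u 1) *
          ((u (L - 1) 2)⁻¹ * fP L y n u 2))
        = (if n = 1 then (0 : ℂ) else 1) / (x - 1) *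
            symSum L t (fun u => (u (L - 1) 1)⁻¹ *
              (-f0 L u 1 + (∑ m ∈ Finset.Icc 1 n, fP L x m u 1)
                + x * ∑ m ∈ Finset.Icc (n + 1) (L - 1), fP L x m u 1) *
              ((u (L - 1) 2)⁻¹ * fP L y n u 2))
          + symSum L t (fun u => ((u (L - 1) 1)⁻¹ * fP L x n u 1) *
              ((u (L - 1) 2)⁻¹ * fP L x n u 2))
          + y * (x - y) * symSum L t (fun u => ((1 - x * u (L - 1) 1)⁻¹ * (1 - x * u (L - 1) 2)⁻¹
        * (1 - y * u (L - 1) 1)⁻¹ * (1 - y * u (L - 1) 2)⁻¹)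
         * BB ((Finset.Icc 1 (L - 1)).erase n) u) := by
  have hx : x - 1 ≠ 0 := sub_ne_zero.2 hx1
  have I : symSum L t (fun u => ∑ m ∈ Finset.Ico n (L - 1),
      EE m u * TT L x y u * BB ((Finset.Icc 1 (L - 1)).erase n) u) = 0 := by
    rw [symSum_sum]
    refine Finset.sum_eq_zero fun m hm => ?_
    rw [Finset.mem_Ico] at hm
    exact sym_interior h n m hn hm.1 hm.2
  have B : symSum L t (fun u => (if n = 1 then (0 : ℂ) else 1) *
      ((-(u n 1 * (u n 1 - u (n - 1) 2)⁻¹) - u n 1 * (u (n - 1) 1 - u n 1)⁻¹)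
      * TT L x y u * BB ((Finset.Icc 1 (L - 1)).erase n) u)) = 0 := by
    rw [symSum_mul]
    by_cases h1 : n = 1
    · simp [h1]
    · rw [sym_boundary h n (by omega) hnL, mul_zero]
  have T := sym_top h n hn hnL
  rw [← symSum_mul, ← symSum_mul, ← symSum_add, ← symSum_add]
  refine symSum_split h I B T fun u hu => ?_
  rw [bracket hu n hn hnL, Cf_eq_s14 hu n hn hnL, ← Finset.sum_mul, ← Finset.sum_mul]
  have e1 := fP_mul_s14 L n x y u
  have e2 := fP_mul_s14 L n x x u
  unfold TT
  generalize ∑ m ∈ Finset.Ico n (L - 1), EE m u = E at *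
  generalize BB _ u = B' at *
  have c : (if n = 1 then (0 : ℂ) else -(u n 1 * (u n 1 - u (n - 1) 2)⁻¹)) =
      (if n = 1 then (0 : ℂ) else 1) * -(u n 1 * (u n 1 - u (n - 1) 2)⁻¹) := by
    split_ifs <;> simp
  rw [c]
  generalize (if n = 1 then (0 : ℂ) else 1) = d
  have hd : d / (x - 1) * (x - 1) = d := div_mul_cancel₀ _ hx
  generalize d / (x - 1) = d' at *
  subst hd
  generalize fP L x n u 1 = F1 at *
  generalize fP L y n u 2 = F2 at *
  generalize fP L x n u 2 = F3 at *
  generalize u (L - 1) 1 = p at *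
  generalize u (L - 1) 2 = q at *
  generalize (u n 1 - u (n - 1) 2)⁻¹ = i1
  generalize (u (n - 1) 1 - u n 1)⁻¹ = i2
  generalize (p - q)⁻¹ = i3
  generalize (1 - x * p)⁻¹ = X1 at *
  generalize (1 - x * q)⁻¹ = X2 at *
  generalize (1 - y * p)⁻¹ = Y1 at *
  generalize (1 - y * q)⁻¹ = Y2 at *
  generalize p⁻¹ = P
  generalize q⁻¹ = Q
  linear_combination (P * Q * (d' * (x - 1) * -(u n 1 * i1) + E + 2 * p * i3)
    - d' * (x - 1) * u n 1 * i2 * P * Q) * e1 - P * Q * e2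

theorem stmt14 (L : ℕ) (hL : 2 ≤ L) (t : ℕ → ℕ → ℂ) (x y : ℂ)
    (ht01 : t 0 1 = 1) (ht02 : t 0 2 = 1)
    (hadj : ∀ m, 1 ≤ m → m ≤ L - 1 → ∀ a b, (a = 1 ∨ a = 2) → (b = 1 ∨ b = 2) →
      t (m - 1) a ≠ t m b)
    (hver : ∀ m, 1 ≤ m → m ≤ L - 1 → t m 1 ≠ t m 2)
    (hxt : ∀ a, (a = 1 ∨ a = 2) → 1 - x * t (L - 1) a ≠ 0)
    (hyt : ∀ a, (a = 1 ∨ a = 2) → 1 - y * t (L - 1) a ≠ 0)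
    (htL1 : t (L - 1) 1 ≠ 0) (htL2 : t (L - 1) 2 ≠ 0)
    (hxy : x ≠ y) (hx1 : x ≠ 1) :
    -- Statement 14 (Lemma `n = l`): generic identity and the degenerate
    -- identity where both copies carry the parameter `x` (the last term on the
    -- right-hand side is then replaced by zero).
    ∀ n, 1 ≤ n → n ≤ L - 1 →
      (symSum L t (fun u => Cf L n u * ((u (L - 1) 1)⁻¹ * fP L x n u 1) *
          ((u (L - 1) 2)⁻¹ * fP L y n u 2))
        = (if n = 1 then (0 : ℂ) else 1) / (x - 1) *
            symSum L t (fun u => (u (L - 1) 1)⁻¹ *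
              (-f0 L u 1 + (∑ m ∈ Finset.Icc 1 n, fP L x m u 1)
                + x * ∑ m ∈ Finset.Icc (n + 1) (L - 1), fP L x m u 1) *
              ((u (L - 1) 2)⁻¹ * fP L y n u 2))
          + symSum L t (fun u => ((u (L - 1) 1)⁻¹ * fP L x n u 1) *
              ((u (L - 1) 2)⁻¹ * fP L x n u 2))
          + y / (x - y) *
            symSum L t (fun u => (u (L - 1) 1 * u (L - 1) 2)⁻¹ *
              ((fP L x n u 1 - fP L y n u 1) * (fP L x n u 2 - fP L y n u 2))))
      ∧
      (symSum L t (fun u => Cf L n u * ((u (L - 1) 1)⁻¹ * fP L x n u 1) *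
          ((u (L - 1) 2)⁻¹ * fP L x n u 2))
        = (if n = 1 then (0 : ℂ) else 1) / (x - 1) *
            symSum L t (fun u => (u (L - 1) 1)⁻¹ *
              (-f0 L u 1 + (∑ m ∈ Finset.Icc 1 n, fP L x m u 1)
                + x * ∑ m ∈ Finset.Icc (n + 1) (L - 1), fP L x m u 1) *
              ((u (L - 1) 2)⁻¹ * fP L x n u 2))
          + symSum L t (fun u => ((u (L - 1) 1)⁻¹ * fP L x n u 1) *
              ((u (L - 1) 2)⁻¹ * fP L x n u 2))) := by
  intro n hn hnL
  constructor
  · have h : Valid L x y t := ⟨ht01, ht02, hadj, hver, hxt, hyt, htL1, htL2⟩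
    rw [core h hx1 n hn hnL]
    congr 1
    rw [← symSum_mul, ← symSum_mul]
    refine symSum_congr h fun u hu => ?_
    have x1 := hu.hx 1 (by simp)
    have x2 := hu.hx 2 (by simp)
    have y1 := hu.hy 1 (by simp)
    have y2 := hu.hy 2 (by simp)
    have p1 := hu.h1
    have p2 := hu.h2
    have hxy' : x - y ≠ 0 := sub_ne_zero.2 hxy
    unfold fP BB
    rw [Finset.prod_mul_distrib]
    generalize ∏ m ∈ (Finset.Icc 1 (L - 1)).erase n, (u (m - 1) 1 - u m 1)⁻¹ = A
    generalize ∏ m ∈ (Finset.Icc 1 (L - 1)).erase n, (u (m - 1) 2 - u m 2)⁻¹ = B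
    generalize u (L - 1) 1 = p at *
    generalize u (L - 1) 2 = q at *
    have ep : (1 - x * p)⁻¹ * A - (1 - y * p)⁻¹ * A =
        (x - y) * p * ((1 - x * p)⁻¹ * (1 - y * p)⁻¹) * A := by
      linear_combination A * ((1 - y * p)⁻¹ * mul_inv_cancel₀ x1
        - (1 - x * p)⁻¹ * mul_inv_cancel₀ y1)
    have eq : (1 - x * q)⁻¹ * B - (1 - y * q)⁻¹ * B =
        (x - y) * q * ((1 - x * q)⁻¹ * (1 - y * q)⁻¹) * B := by
      linear_combination B * ((1 - y * q)⁻¹ * mul_inv_cancel₀ x2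
        - (1 - x * q)⁻¹ * mul_inv_cancel₀ y2)
    rw [ep, eq]
    field_simp
  · have h : Valid L x x t := ⟨ht01, ht02, hadj, hver, hxt, hxt, htL1, htL2⟩
    rw [core h hx1 n hn hnL]
    simp
end
end
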